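/- arXiv:0905.2796 — 3 statements merged into one kernel-verified Lean document; each statement's English description precedes it below -/
import Mathlib

section
/- Let d_1 ≥ d_2 ≥ ... ≥ d_L be positive integers (the sizes of the classes sorted in decreasing order) with d_1 + ... + d_L ≥ k for a positive integer k, and let t be the smallest integer such that d_1 + ... + d_t ≥ k. Then for any nonnegative integers x_1, ..., x_L satisfying x_ℓ ≤ d_ℓ for all ℓ and x_1 + ... + x_L = k, one has (1/k)·∑_{ℓ=1}^{L} d_ℓ·x_ℓ ≤ d_t + (1/k)·∑_{i=1}^{t−1} d_i·(d_i − d_t). -/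
/-- Weak duality for the fractional knapsack problem: a linear functional with weights `w` on
vectors `x` with `0 ≤ x ≤ u` is at most the value of the dual solution with threshold `c`. -/
theorem Finset.sum_mul_le_threshold {ι : Type*} {s T : Finset ι} (hs : s ⊆ T) (c : ℝ)
    (w u x : ι → ℝ) (hw : ∀ i ∈ s, c ≤ w i) (hxu : ∀ i ∈ s, x i ≤ u i)
    (hw' : ∀ i ∈ T, i ∉ s → w i ≤ c) (hx : ∀ i ∈ T, i ∉ s → 0 ≤ x i) :
    ∑ i ∈ T, w i * x i ≤ c * ∑ i ∈ T, x i + ∑ i ∈ s, u i * (w i - c) := by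
  classical
  have hin : ∑ i ∈ s, w i * x i ≤ c * ∑ i ∈ s, x i + ∑ i ∈ s, u i * (w i - c) := by
    rw [Finset.mul_sum, ← Finset.sum_add_distrib]
    refine Finset.sum_le_sum fun i hi => ?_
    linarith [mul_le_mul_of_nonneg_right (hxu i hi) (sub_nonneg.2 (hw i hi))]
  have hout : ∑ i ∈ T \ s, w i * x i ≤ c * ∑ i ∈ T \ s, x i := by
    rw [Finset.mul_sum]
    refine Finset.sum_le_sum fun i hi => ?_
    obtain ⟨hiT, his⟩ := Finset.mem_sdiff.1 hi
    exact mul_le_mul_of_nonneg_right (hw' i hiT his) (hx i hiT his)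
  rw [← Finset.sum_sdiff hs, ← Finset.sum_sdiff (f := x) hs, mul_add]
  linarith

/-- Theorem 1 of the paper (worst-case decoding complexity bound, first inequality):
if `d 1 ≥ d 2 ≥ ... ≥ d L > 0` are the class sizes sorted in decreasing order,
`k > 0`, `d 1 + ... + d L ≥ k`, and `t` is the smallest integer with
`d 1 + ... + d t ≥ k`, then for any nonnegative integers `x ℓ ≤ d ℓ` summing to `k`,
`(1/k) * ∑ ℓ, d ℓ * x ℓ ≤ d t + (1/k) * ∑_{i=1}^{t-1} d i * (d i - d t)`. -/
theorem complexity_bound_first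
    (L k t : ℕ) (d x : ℕ → ℕ)
    (hk : 0 < k)
    (hpos : ∀ i ∈ Finset.Icc 1 L, 0 < d i)
    (hsorted : ∀ i j : ℕ, 1 ≤ i → i ≤ j → j ≤ L → d j ≤ d i)
    (hsum : k ≤ ∑ i ∈ Finset.Icc 1 L, d i)
    (ht1 : 1 ≤ t) (htL : t ≤ L)
    (htk : k ≤ ∑ i ∈ Finset.Icc 1 t, d i)
    (htmin : ∀ t' : ℕ, t' < t → ∑ i ∈ Finset.Icc 1 t', d i < k)
    (hx : ∀ ℓ ∈ Finset.Icc 1 L, x ℓ ≤ d ℓ)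
    (hxsum : ∑ ℓ ∈ Finset.Icc 1 L, x ℓ = k) :
    (1 / (k : ℝ)) * ∑ ℓ ∈ Finset.Icc 1 L, (d ℓ : ℝ) * (x ℓ : ℝ) ≤
      (d t : ℝ) +
        (1 / (k : ℝ)) * ∑ i ∈ Finset.Icc 1 (t - 1), (d i : ℝ) * ((d i : ℝ) - (d t : ℝ)) := by
  have hk' : (0 : ℝ) < k := by exact_mod_cast hk
  have hxsum' : ∑ ℓ ∈ Finset.Icc 1 L, (x ℓ : ℝ) = k := by exact_mod_cast hxsum
  have key := Finset.sum_mul_le_threshold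
    (Finset.Icc_subset_Icc_right (a := 1) (show t - 1 ≤ L by lia))
    (d t : ℝ) (fun i => (d i : ℝ)) (fun i => (d i : ℝ)) (fun i => (x i : ℝ))
    (fun i hi => by
      rw [Finset.mem_Icc] at hi
      exact_mod_cast hsorted i t hi.1 (by lia) htL)
    (fun i hi => by
      rw [Finset.mem_Icc] at hi
      exact_mod_cast hx i (Finset.mem_Icc.2 ⟨hi.1, by lia⟩))
    (fun i hi hit => by
      rw [Finset.mem_Icc] at hi hit
      exact_mod_cast hsorted t i ht1 (by lia) hi.2)
    (fun i _ _ => Nat.cast_nonneg _)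
  rw [hxsum'] at key
  calc _ ≤ (1 / (k : ℝ)) * (d t * k +
        ∑ i ∈ Finset.Icc 1 (t - 1), (d i : ℝ) * ((d i : ℝ) - (d t : ℝ))) := by gcongr
    _ = _ := by field_simp
end

section
/- Let k = L_0·d and L ≤ L_0². In a (k, d, L) diagonal grid code, every packet index u ∈ {0, ..., k−1} belongs to at least ⌊L/L_0⌋ and at most ⌈L/L_0⌉ classes. (Each complete layer of L_0 classes contains u exactly once, and the possibly incomplete last layer contains u at most once.) -/
/-- Class `C ℓ` of a `(k, d, L)` diagonal grid code with `k = L₀ * d` and angle set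
`Θ`: `C ℓ = {((i + j·θ_s)·d + j) mod k : j = 0, ..., d-1}` where `i = ℓ mod L₀` and
`s = ⌊ℓ / L₀⌋`. -/
def diagClass (L₀ d : ℕ) (Θ : ℕ → ℤ) (ℓ : ℕ) : Finset ℤ :=
  (Finset.range d).image fun j : ℕ =>
    ((((ℓ % L₀ : ℕ) : ℤ) + (j : ℤ) * Θ (ℓ / L₀)) * (d : ℤ) + (j : ℤ)) % ((L₀ : ℤ) * (d : ℤ))

theorem mul_add_emod_mul_eq_iff {n d x j u : ℤ} (hd : 0 < d) (hj : 0 ≤ j)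
    (hjd : j < d) (hu : 0 ≤ u) (hun : u < n * d) :
    (x * d + j) % (n * d) = u ↔ j = u % d ∧ x ≡ u / d [ZMOD n] := by
  have hmod : (x * d + j) % d = j := by
    rw [add_comm, Int.add_mul_emod_self_right, Int.emod_eq_of_lt hj hjd]
  constructor
  · intro h
    have hmodEq : x * d + j ≡ u [ZMOD n * d] := by
      rw [Int.ModEq, h, Int.emod_eq_of_lt hu hun]
    have hjmod : j = u % d := by
      rw [← hmod]
      exact hmodEq.of_mul_left n
    refine ⟨hjmod, ?_⟩
    obtain ⟨c, hc⟩ := hmodEq.dvd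
    have hu' := Int.emod_add_mul_ediv u d
    refine Int.modEq_iff_dvd.2 ⟨c, mul_left_cancel₀ hd.ne' ?_⟩
    linear_combination hc + hu' + hjmod
  · rintro ⟨hjmod, hx⟩
    obtain ⟨c, hc⟩ := hx.dvd
    have hu' := Int.emod_add_mul_ediv u d
    have hmodEq : x * d + j ≡ u [ZMOD n * d] :=
      Int.modEq_iff_dvd.2 ⟨c, by linear_combination d * hc - hu' - hjmod⟩
    rw [hmodEq, Int.emod_eq_of_lt hu hun]

/-- The unique position, inside layer `s`, of the class containing the packet `u`. -/
def diagPosition (L₀ d : ℕ) (Θ : ℕ → ℤ) (u s : ℕ) : ℕ :=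
  (((u : ℤ) / d - (u : ℤ) % d * Θ s) % L₀).toNat

theorem diagPosition_lt {L₀ : ℕ} (hL₀ : 0 < L₀) (d : ℕ) (Θ : ℕ → ℤ) (u s : ℕ) :
    diagPosition L₀ d Θ u s < L₀ := by
  have h := Int.emod_lt_of_pos ((u : ℤ) / d - (u : ℤ) % d * Θ s) (Int.natCast_pos.2 hL₀)
  unfold diagPosition
  omega

theorem mem_diagClass_iff {L₀ d : ℕ} (hL₀ : 0 < L₀) (hd : 0 < d) (Θ : ℕ → ℤ) {u : ℕ}
    (hu : u < L₀ * d) (ℓ : ℕ) :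
    (u : ℤ) ∈ diagClass L₀ d Θ ℓ ↔ ℓ % L₀ = diagPosition L₀ d Θ u (ℓ / L₀) := by
  have hL₀' : (0 : ℤ) < L₀ := Int.natCast_pos.2 hL₀
  have hd' : (0 : ℤ) < d := Int.natCast_pos.2 hd
  have hu' : (u : ℤ) < L₀ * d := by exact_mod_cast hu
  have hpos : ℓ % L₀ = diagPosition L₀ d Θ u (ℓ / L₀) ↔
      ((ℓ % L₀ : ℕ) : ℤ) + (u : ℤ) % d * Θ (ℓ / L₀) ≡ (u : ℤ) / d [ZMOD L₀] := by
    have hnonneg := Int.emod_nonneg ((u : ℤ) / d - (u : ℤ) % d * Θ (ℓ / L₀)) hL₀'.ne'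
    have hlt : ((ℓ % L₀ : ℕ) : ℤ) < L₀ := by exact_mod_cast Nat.mod_lt ℓ hL₀
    rw [diagPosition, ← Int.natCast_inj, Int.toNat_of_nonneg hnonneg,
      ← Int.emod_eq_of_lt (Int.natCast_nonneg (ℓ % L₀)) hlt]
    change _ ≡ _ [ZMOD _] ↔ _
    rw [Int.emod_eq_of_lt (Int.natCast_nonneg (ℓ % L₀)) hlt, Int.modEq_iff_dvd,
      Int.modEq_iff_dvd, sub_sub, add_comm ((u : ℤ) % d * _)]
  rw [hpos]
  simp only [diagClass, Finset.mem_image, Finset.mem_range]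
  constructor
  · rintro ⟨j, hj, h⟩
    obtain ⟨hjmod, hx⟩ := (mul_add_emod_mul_eq_iff hd' (Int.natCast_nonneg j)
      (by exact_mod_cast hj) (Int.natCast_nonneg u) hu').1 h
    rwa [← hjmod]
  · intro h
    refine ⟨u % d, Nat.mod_lt u hd, ?_⟩
    rw [mul_add_emod_mul_eq_iff hd' (Int.natCast_nonneg _)
      (by exact_mod_cast Nat.mod_lt u hd) (Int.natCast_nonneg u) hu']
    exact ⟨Int.natCast_mod u d, by rwa [Int.natCast_mod u d]⟩

theorem card_filter_mod_eq_bounds {n : ℕ} (hn : 0 < n) (L : ℕ) {r : ℕ → ℕ}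
    (hr : ∀ s, r s < n) :
    L / n ≤ ((Finset.range L).filter fun ℓ => ℓ % n = r (ℓ / n)).card ∧
      ((Finset.range L).filter fun ℓ => ℓ % n = r (ℓ / n)).card ≤ (L + n - 1) / n := by
  have hdiv (s : ℕ) : (r s + n * s) / n = s := by
    rw [Nat.add_mul_div_left _ _ hn, Nat.div_eq_of_lt (hr s), zero_add]
  constructor
  · conv_lhs => rw [← Finset.card_range (L / n)]
    refine Finset.card_le_card_of_injOn (fun s => r s + n * s) ?_ ?_
    · intro s hs
      have hs' : s + 1 ≤ L / n := Finset.mem_range.1 hs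
      have hle : (s + 1) * n ≤ L := (Nat.le_div_iff_mul_le hn).1 hs'
      have hlt := hr s
      simp only [Finset.coe_filter, Finset.mem_range, Set.mem_ofPred_eq, hdiv,
        Nat.add_mul_mod_self_left, Nat.mod_eq_of_lt hlt, and_true]
      nlinarith
    · intro s _ t _ h
      rw [← hdiv s, ← hdiv t]
      exact congrArg (· / n) h
  · conv_rhs => rw [← Finset.card_range ((L + n - 1) / n)]
    refine Finset.card_le_card_of_injOn (· / n) ?_ ?_
    · intro ℓ hℓ
      have hlt : ℓ < L := Finset.mem_range.1 (Finset.mem_filter.1 hℓ).1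
      refine Finset.mem_coe.2 (Finset.mem_range.2 ?_)
      rw [← Nat.succ_le_iff, Nat.succ_eq_add_one, ← Nat.add_div_right ℓ hn]
      exact Nat.div_le_div_right (by omega)
    · intro a ha b hb h
      have ha' := (Finset.mem_filter.1 ha).2
      have hb' := (Finset.mem_filter.1 hb).2
      have h' : a / n = b / n := h
      rw [← Nat.mod_add_div a n, ← Nat.mod_add_div b n, ha', hb', h']

/-- Let `k = L₀ * d` and `L ≤ L₀²`. In a `(k, d, L)` diagonal grid code, every packet
index `u ∈ {0, ..., k-1}` belongs to at least `⌊L/L₀⌋` and at most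
`⌈L/L₀⌉ = (L + L₀ - 1)/L₀` classes. -/
theorem diag_grid_membership_count (L₀ d L : ℕ) (hL₀ : 0 < L₀) (hd : 0 < d)
    (hL : L ≤ L₀ * L₀) (Θ : ℕ → ℤ) (u : ℕ) (hu : u < L₀ * d) :
    L / L₀ ≤ ((Finset.range L).filter fun ℓ => (u : ℤ) ∈ diagClass L₀ d Θ ℓ).card ∧
      ((Finset.range L).filter fun ℓ => (u : ℤ) ∈ diagClass L₀ d Θ ℓ).card ≤
        (L + L₀ - 1) / L₀ := by
  simp only [mem_diagClass_iff hL₀ hd Θ hu]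
  exact card_filter_mod_eq_bounds hL₀ L (diagPosition_lt hL₀ d Θ u)
end

section
/- Let k = L_0·d and L ≤ L_0². In a (k, d, L) diagonal grid code, consider two classes C_ℓ and C_{ℓ'} from distinct layers s = ⌊ℓ/L_0⌋ ≠ s' = ⌊ℓ'/L_0⌋ whose angle difference θ_s − θ_{s'} is relatively prime to L_0. Then |C_ℓ ∩ C_{ℓ'}| ≤ ⌈d/L_0⌉. -/
/-- Two grid positions with columns `j, j' < d` coincide modulo `L₀ * d` only if the columns
agree and the rows are congruent modulo `L₀`. -/
theorem eq_and_dvd_of_grid_emod_eq {L₀ d j j' : ℕ} {a a' : ℤ} (hj : j < d) (hj' : j' < d)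
    (h : (a * d + j) % ((L₀ : ℤ) * d) = (a' * d + j') % ((L₀ : ℤ) * d)) :
    j = j' ∧ (L₀ : ℤ) ∣ a' - a := by
  have hmod : a * d + j ≡ a' * d + j' [ZMOD (L₀ : ℤ) * d] := h
  have hd : (d : ℤ) ≠ 0 := by omega
  have hcol : (a * d + j) % (d : ℤ) = (a' * d + j') % d := hmod.of_mul_left _
  rw [Int.mul_add_emod_self_right, Int.mul_add_emod_self_right] at hcol
  norm_cast at hcol
  rw [Nat.mod_eq_of_lt hj, Nat.mod_eq_of_lt hj'] at hcol
  subst hcol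
  refine ⟨rfl, Int.dvd_of_mul_dvd_mul_right hd ?_⟩
  convert hmod.dvd using 1
  ring

/-- A set of naturals below `d`, pairwise congruent modulo `m`, has at most `⌈d / m⌉` elements. -/
theorem card_le_of_forall_modEq {m d : ℕ} (hm : 0 < m) {S : Finset ℕ}
    (hS : ∀ j ∈ S, j < d) (hmod : ∀ x ∈ S, ∀ y ∈ S, x ≡ y [MOD m]) :
    S.card ≤ (d + m - 1) / m := by
  rw [← Finset.card_range ((d + m - 1) / m)]
  refine Finset.card_le_card_of_injOn (· / m) (fun j hj => ?_) fun x hx y hy hxy => ?_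
  · have := hS j hj
    have hle : (j + m) / m ≤ (d + m - 1) / m := Nat.div_le_div_right (by omega)
    rw [Nat.add_div_right _ hm] at hle
    simpa using hle
  · have hr : x % m = y % m := hmod x hx y hy
    have hq : x / m = y / m := hxy
    rw [← Nat.div_add_mod x m, ← Nat.div_add_mod y m, hq, hr]

/-- Let `k = L₀ * d` and `L ≤ L₀²`. In a `(k, d, L)` diagonal grid code, if `C ℓ` and
`C ℓ'` come from distinct layers `s = ⌊ℓ/L₀⌋ ≠ s' = ⌊ℓ'/L₀⌋` whose angle difference
`θ_s - θ_s'` is relatively prime to `L₀`, then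
`|C ℓ ∩ C ℓ'| ≤ ⌈d/L₀⌉ = (d + L₀ - 1)/L₀`. -/
theorem diag_grid_intersection_bound (L₀ d L : ℕ) (hL₀ : 0 < L₀) (hd : 0 < d)
    (hL : L ≤ L₀ * L₀) (Θ : ℕ → ℤ) (ℓ ℓ' : ℕ) (hℓ : ℓ < L) (hℓ' : ℓ' < L)
    (hlayers : ℓ / L₀ ≠ ℓ' / L₀)
    (hcop : Int.gcd (Θ (ℓ / L₀) - Θ (ℓ' / L₀)) (L₀ : ℤ) = 1) :
    (diagClass L₀ d Θ ℓ ∩ diagClass L₀ d Θ ℓ').card ≤ (d + L₀ - 1) / L₀ := by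
  set δ := Θ (ℓ / L₀) - Θ (ℓ' / L₀) with hδ
  let S := (Finset.range d).filter fun j : ℕ =>
    (L₀ : ℤ) ∣ ((ℓ' % L₀ : ℕ) : ℤ) - ((ℓ % L₀ : ℕ) : ℤ) - j * δ
  have hsub : diagClass L₀ d Θ ℓ ∩ diagClass L₀ d Θ ℓ' ⊆ S.image fun j : ℕ =>
      ((((ℓ % L₀ : ℕ) : ℤ) + (j : ℤ) * Θ (ℓ / L₀)) * (d : ℤ) + (j : ℤ)) %
        ((L₀ : ℤ) * (d : ℤ)) := by
    intro x hx
    simp only [diagClass, Finset.mem_inter, Finset.mem_image, Finset.mem_range] at hx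
    obtain ⟨⟨j, hj, rfl⟩, j', hj', h⟩ := hx
    obtain ⟨rfl, hdvd⟩ := eq_and_dvd_of_grid_emod_eq hj hj' h.symm
    refine Finset.mem_image_of_mem _ (Finset.mem_filter.2 ⟨Finset.mem_range.2 hj, ?_⟩)
    convert hdvd using 1
    rw [hδ]
    ring
  refine (Finset.card_le_card hsub).trans (Finset.card_image_le.trans ?_)
  refine card_le_of_forall_modEq hL₀
    (fun j hj => Finset.mem_range.1 (Finset.mem_filter.1 hj).1) fun x hx y hy => ?_
  have hdvd : (L₀ : ℤ) ∣ δ * ((y : ℤ) - x) := by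
    convert Int.dvd_sub (Finset.mem_filter.1 hx).2 (Finset.mem_filter.1 hy).2 using 1
    ring
  rw [Int.gcd_comm] at hcop
  exact Nat.modEq_iff_dvd.2 (Int.dvd_of_dvd_mul_right_of_gcd_one hdvd hcop)
end
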